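/- arXiv:1712.06559 — 12 statements merged into one kernel-verified Lean document; each statement's English description precedes it below -/
import Mathlib

section
/- In the convex interpolation setting, for every batch size m ≥ 1, mini-batch SGD with constant step size η*(m) = m/(β + λ(m−1)) satisfies, for every t ≥ 0, E[L(w_t)] ≤ (λ/2)·(1 − η*(m)·α)^t·‖w₀ − w*‖². -/
open RealInnerProductSpace Finset

/-- Expected value of `φ` after `t` steps of the Markov chain defined by `step`,
starting at a given point, where at each step a mini-batch index tuple
`s : Fin m → Fin n` is drawn uniformly (i.i.d. indices). -/
noncomputable def sgdExp {H : Type*} (n m : ℕ) (step : (Fin m → Fin n) → H → H)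
    (φ : H → ℝ) : ℕ → H → ℝ
  | 0 => φ
  | t + 1 => fun w => (1 / (n : ℝ) ^ m) * ∑ s : Fin m → Fin n, sgdExp n m step φ t (step s w)

/-- Second moment of `x` plus a sum of `m` i.i.d. uniform draws from a family of `n` vectors with
mean `μ` and mean squared norm `A`, written as a sum over all draws. -/
lemma sum_norm_add_sum_draws_sq {H : Type*} [NormedAddCommGroup H] [InnerProductSpace ℝ H]
    {n : ℕ} (a : Fin n → H) (μ : H) (A : ℝ) (hμ : ∑ i, a i = (n : ℝ) • μ)
    (hA : ∑ i, ‖a i‖ ^ 2 = n * A) (m : ℕ) (x : H) :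
    ∑ s : Fin m → Fin n, ‖x + ∑ j, a (s j)‖ ^ 2
      = (n : ℝ) ^ m * (‖x‖ ^ 2 + 2 * m * ⟪x, μ⟫ + m * A + m * (m - 1) * ‖μ‖ ^ 2) := by
  induction m generalizing x with
  | zero => simp
  | succ m ih =>
    have hx : ∑ i, ⟪x, a i⟫ = n * ⟪x, μ⟫ := by
      rw [← inner_sum, hμ, real_inner_smul_right]
    have hm : ∑ i, ⟪a i, μ⟫ = n * ‖μ‖ ^ 2 := by
      rw [← sum_inner, hμ, real_inner_smul_left, real_inner_self_eq_norm_sq]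
    rw [← (Fin.consEquiv fun _ : Fin (m + 1) => Fin n).sum_comp, Fintype.sum_prod_type]
    simp only [Fin.consEquiv_apply, Fin.sum_univ_succ, Fin.cons_zero, Fin.cons_succ, ← add_assoc,
      ih, ← mul_sum]
    simp only [norm_add_sq_real, inner_add_left, sum_add_distrib, mul_add, ← mul_sum, hx, hm, hA,
      sum_const, card_univ, Fintype.card_fin, nsmul_eq_mul]
    push_cast
    ring

/-- A nonnegative function with a quadratic upper bound at `w` satisfies `‖∇f(w)‖² ≤ 2 c f(w)`. -/
lemma norm_sq_le_of_nonneg_of_quadratic_upper_bound {H : Type*} [NormedAddCommGroup H]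
    [InnerProductSpace ℝ H] {f : H → ℝ} {w d : H} {c : ℝ} (hc : 0 ≤ c) (hf : ∀ v, 0 ≤ f v)
    (hs : ∀ v, f v ≤ f w + ⟪d, v - w⟫ + c / 2 * ‖v - w‖ ^ 2) :
    ‖d‖ ^ 2 ≤ 2 * c * f w := by
  rcases eq_or_ne d 0 with rfl | hd
  · have := mul_nonneg hc (hf w)
    simp only [norm_zero]
    linarith
  have hpos : 0 < ‖d‖ ^ 2 := by positivity
  have key : ∀ r : ℝ, 0 ≤ c / 2 * ‖d‖ ^ 2 * (r * r) + ‖d‖ ^ 2 * r + f w := fun r => by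
    have h := (hf _).trans (hs (w + r • d))
    rw [add_sub_cancel_left, real_inner_smul_right, real_inner_self_eq_norm_sq, norm_smul, mul_pow,
      Real.norm_eq_abs, sq_abs] at h
    linarith
  have h := discrim_le_zero key
  rw [discrim] at h
  refine le_of_mul_le_mul_left ?_ hpos
  linarith

/-- The modulus of a quadratic upper bound of a function lying above its tangents is nonnegative. -/
lemma quadratic_upper_bound_modulus_nonneg {H : Type*} [NormedAddCommGroup H]
    [InnerProductSpace ℝ H] [Nontrivial H] {f : H → ℝ} {w d : H} {c : ℝ}
    (hf : ∀ v, f w + ⟪d, v - w⟫ ≤ f v)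
    (hs : ∀ v, f v ≤ f w + ⟪d, v - w⟫ + c / 2 * ‖v - w‖ ^ 2) : 0 ≤ c := by
  obtain ⟨v, hv⟩ := exists_ne w
  have hpos : 0 < ‖v - w‖ ^ 2 := by
    have := norm_pos_iff.2 (sub_ne_zero.2 hv)
    positivity
  have h : 0 ≤ c / 2 * ‖v - w‖ ^ 2 := by linarith [hf v, hs v]
  linarith [nonneg_of_mul_nonneg_left h hpos]

/-- If every step contracts `ψ` on average by the factor `ρ`, then `t` steps contract it by `ρ ^ t`. -/
lemma sgdExp_le_mul_pow_mul {H : Type*} {n m : ℕ} {step : (Fin m → Fin n) → H → H}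
    {φ ψ : H → ℝ} {c ρ : ℝ} (hc : 0 ≤ c) (hρ : 0 ≤ ρ) (hφ : ∀ w, φ w ≤ c * ψ w)
    (hψ : ∀ w, (1 / (n : ℝ) ^ m) * ∑ s, ψ (step s w) ≤ ρ * ψ w) (t : ℕ) (w : H) :
    sgdExp n m step φ t w ≤ c * ρ ^ t * ψ w := by
  induction t generalizing w with
  | zero => simpa [sgdExp] using hφ w
  | succ t ih =>
    calc sgdExp n m step φ (t + 1) w
        ≤ (1 / (n : ℝ) ^ m) * ∑ s, c * ρ ^ t * ψ (step s w) :=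
          mul_le_mul_of_nonneg_left (sum_le_sum fun s _ => ih _) (by positivity)
      _ = c * ρ ^ t * ((1 / (n : ℝ) ^ m) * ∑ s, ψ (step s w)) := by rw [← mul_sum]; ring
      _ ≤ c * ρ ^ t * (ρ * ψ w) := mul_le_mul_of_nonneg_left (hψ w) (by positivity)
      _ = c * ρ ^ (t + 1) * ψ w := by ring

/-- In the convex interpolation setting, mini-batch SGD with constant step size
`η*(m) = m/(β + λ(m−1))` satisfies `E[L(w_t)] ≤ (λ/2)(1 − η*(m)α)^t ‖w₀ − w*‖²`. -/
theorem sgd_interpolation_exponential_convergence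
    {H : Type*} [NormedAddCommGroup H] [InnerProductSpace ℝ H] [CompleteSpace H]
    (n : ℕ) (hn : 1 ≤ n)
    (ℓ : Fin n → H → ℝ) (g : Fin n → H → H)
    (β lam α : ℝ)
    (hgrad : ∀ i w, HasGradientAt (ℓ i) (g i w) w)
    (hnonneg : ∀ i w, 0 ≤ ℓ i w)
    (hconvex : ∀ i w v, ℓ i w + ⟪g i w, v - w⟫ ≤ ℓ i v)
    (hsmooth : ∀ i w v, ℓ i v ≤ ℓ i w + ⟪g i w, v - w⟫ + β / 2 * ‖v - w‖ ^ 2)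
    (L : H → ℝ) (hL : ∀ w, L w = (1 / (n : ℝ)) * ∑ i, ℓ i w)
    (gL : H → H) (hgL : ∀ w, HasGradientAt L (gL w) w)
    (hLsmooth : ∀ w v, L v ≤ L w + ⟪gL w, v - w⟫ + lam / 2 * ‖v - w‖ ^ 2)
    (hLstrong : ∀ w v, L w + ⟪gL w, v - w⟫ + α / 2 * ‖v - w‖ ^ 2 ≤ L v)
    (wstar : H) (hmin : ∀ w, L wstar ≤ L w)
    (hinterp : ∀ i, ℓ i wstar = 0)
    (m : ℕ) (hm : 1 ≤ m)
    (η : ℝ) (hη : η = (m : ℝ) / (β + lam * ((m : ℝ) - 1)))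
    (w0 : H) :
    ∀ t : ℕ,
      sgdExp n m (fun s w => w - (η / (m : ℝ)) • ∑ j, g (s j) w) L t w0
        ≤ lam / 2 * (1 - η * α) ^ t * ‖w0 - wstar‖ ^ 2 := by
  intro t
  have hn0 : (n : ℝ) ≠ 0 := by positivity
  have hm0 : (m : ℝ) ≠ 0 := by positivity
  have hm1 : (0 : ℝ) ≤ m - 1 := by
    have : (1 : ℝ) ≤ m := by exact_mod_cast hm
    linarith
  have hLstar : L wstar = 0 := by simp [hL, hinterp]
  have hLnonneg : ∀ w, 0 ≤ L w := fun w => hLstar ▸ hmin w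
  rcases subsingleton_or_nontrivial H with hH | hH
  · have hzero : ∀ w, L w = 0 := fun w => by rw [Subsingleton.elim w wstar, hLstar]
    have h := sgdExp_le_mul_pow_mul (n := n) (m := m)
      (step := fun s w => w - (η / (m : ℝ)) • ∑ j, g (s j) w) (φ := L) (ψ := fun _ => 0)
      (le_refl (0 : ℝ)) (le_refl (0 : ℝ)) (fun w => by simp [hzero]) (fun w => by simp) t w0
    simpa [Subsingleton.elim w0 wstar] using h
  have hgsum : ∀ w, ∑ i, g i w = (n : ℝ) • gL w := fun w => by
    have h1 : HasFDerivAt (fun v => ∑ i, ℓ i v) (∑ i, InnerProductSpace.toDual ℝ H (g i w)) w :=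
      HasFDerivAt.fun_sum fun i _ => (hgrad i w).hasFDerivAt
    have h2 : HasFDerivAt (fun v => (n : ℝ) * L v) ((n : ℝ) • InnerProductSpace.toDual ℝ H (gL w))
        w := (hgL w).hasFDerivAt.const_mul _
    have h3 : (fun v => (n : ℝ) * L v) = fun v => ∑ i, ℓ i v := by
      funext v
      rw [hL]
      field_simp
    rw [h3] at h2
    apply (InnerProductSpace.toDual ℝ H).injective
    simpa using h1.unique h2
  have hLconvex : ∀ w v, L w + ⟪gL w, v - w⟫ ≤ L v := fun w v => by
    have h := sum_le_sum fun i (_ : i ∈ univ) => hconvex i w v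
    rw [sum_add_distrib, ← sum_inner, hgsum, real_inner_smul_left] at h
    rw [hL, hL]
    have h' := mul_le_mul_of_nonneg_left h (by positivity : 0 ≤ 1 / (n : ℝ))
    rwa [mul_add, ← mul_assoc (1 / (n : ℝ)) n, one_div_mul_cancel hn0, one_mul] at h'
  have hβ : 0 ≤ β :=
    quadratic_upper_bound_modulus_nonneg (hconvex ⟨0, hn⟩ wstar) (hsmooth ⟨0, hn⟩ wstar)
  have hlam : 0 ≤ lam := quadratic_upper_bound_modulus_nonneg (hLconvex wstar) (hLsmooth wstar)
  have hη0 : 0 ≤ η := by rw [hη]; positivity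
  have hη2 : η ^ 2 * (β + lam * ((m : ℝ) - 1)) = m * η := by
    rcases eq_or_ne (β + lam * ((m : ℝ) - 1)) 0 with h | h
    · simp [hη, h]
    · rw [hη]
      field_simp
  have hgLstar : gL wstar = 0 := by
    have h := norm_sq_le_of_nonneg_of_quadratic_upper_bound hlam hLnonneg (hLsmooth wstar)
    rw [hLstar, mul_zero] at h
    exact norm_eq_zero.1 (pow_eq_zero_iff two_ne_zero |>.1 (le_antisymm h (by positivity)))
  have hstep : ∀ w, (1 / (n : ℝ) ^ m) * ∑ s : Fin m → Fin n,
      ‖w - (η / (m : ℝ)) • ∑ j, g (s j) w - wstar‖ ^ 2 ≤ (1 - η * α) * ‖w - wstar‖ ^ 2 := fun w => by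
    set A : ℝ := (1 / (n : ℝ)) * ∑ i, ‖g i w‖ ^ 2 with hA
    have hAle : A ≤ 2 * β * L w := by
      rw [hA, hL, mul_left_comm, mul_sum univ _ (2 * β)]
      gcongr with i
      exact norm_sq_le_of_nonneg_of_quadratic_upper_bound hβ (hnonneg i) (hsmooth i w)
    have hgLle := norm_sq_le_of_nonneg_of_quadratic_upper_bound hlam hLnonneg (hLsmooth w)
    have hinner : L w + α / 2 * ‖w - wstar‖ ^ 2 ≤ ⟪w - wstar, gL w⟫ := by
      have h := hLstrong w wstar
      rw [← neg_sub w wstar, inner_neg_right, norm_neg, hLstar, real_inner_comm] at h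
      linarith
    have hmoment := sum_norm_add_sum_draws_sq (fun i => -(η / (m : ℝ)) • g i w)
      (-(η / (m : ℝ)) • gL w) ((η / m) ^ 2 * A)
      (by rw [← smul_sum, hgsum, smul_comm])
      (by
        simp only [norm_smul, mul_pow, Real.norm_eq_abs, sq_abs, ← mul_sum, hA, neg_sq]
        field_simp) m (w - wstar)
    have hrw : ∀ s : Fin m → Fin n, w - (η / (m : ℝ)) • ∑ j, g (s j) w - wstar
        = w - wstar + ∑ j, -(η / (m : ℝ)) • g (s j) w := fun s => by
      rw [← smul_sum, neg_smul]
      abel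
    simp only [hrw]
    rw [hmoment, ← mul_assoc, one_div_mul_cancel (pow_ne_zero _ hn0), one_mul,
      real_inner_smul_right, norm_smul, mul_pow, Real.norm_eq_abs, sq_abs]
    have hexpand : ‖w - wstar‖ ^ 2 + 2 * m * (-(η / m) * ⟪w - wstar, gL w⟫) + m * ((η / m) ^ 2 * A)
        + m * (m - 1) * ((-(η / m)) ^ 2 * ‖gL w‖ ^ 2)
        = ‖w - wstar‖ ^ 2 - 2 * η * ⟪w - wstar, gL w⟫
          + η ^ 2 / m * (A + (m - 1) * ‖gL w‖ ^ 2) := by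
      field_simp
      ring
    have hvar : η ^ 2 / m * (A + (m - 1) * ‖gL w‖ ^ 2) ≤ 2 * η * L w :=
      calc η ^ 2 / m * (A + (m - 1) * ‖gL w‖ ^ 2)
          ≤ η ^ 2 / m * (2 * β * L w + (m - 1) * (2 * lam * L w)) := by gcongr
        _ = 2 * (η ^ 2 * (β + lam * ((m : ℝ) - 1))) / m * L w := by ring
        _ = 2 * η * L w := by rw [hη2]; field_simp
    rw [hexpand]
    linarith [mul_le_mul_of_nonneg_left hinner hη0]
  have hρ : 0 ≤ 1 - η * α := by
    obtain ⟨v, hv⟩ := exists_ne wstar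
    have hpos := norm_pos_iff.2 (sub_ne_zero.2 hv)
    exact nonneg_of_mul_nonneg_left ((by positivity : (0 : ℝ) ≤ _).trans (hstep v))
      (by positivity : 0 < ‖v - wstar‖ ^ 2)
  refine sgdExp_le_mul_pow_mul (ψ := fun w => ‖w - wstar‖ ^ 2) (by positivity) hρ (fun w => ?_)
    hstep t w0
  simpa [hLstar, hgLstar] using hLsmooth wstar w
end

section
/- In the convex interpolation setting, with step size η*(m) = m/(β + λ(m−1)): for every w ∈ H, if w' = w − (η*(m)/m)∑_{j=1}^m ∇ℓ_{i_j}(w) where (i₁,…,i_m) ranges uniformly over {1,…,n}^m, then E‖w' − w*‖² ≤ (1 − η*(m)·α)·‖w − w*‖². -/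
open RealInnerProductSpace Finset

section Averages

variable {H : Type*} [NormedAddCommGroup H] [InnerProductSpace ℝ H]

/-- The self-bounding property of a nonnegative `β`-smooth function, multiplied by `‖gradient‖²` so
that it holds whatever the sign of `β`. -/
theorem norm_gradient_pow_four_le {f : H → ℝ} {β : ℝ} {w p : H} (hf : ∀ v, 0 ≤ f v)
    (hsmooth : ∀ v, f v ≤ f w + ⟪p, v - w⟫ + β / 2 * ‖v - w‖ ^ 2) :
    (‖p‖ ^ 2) ^ 2 ≤ 2 * β * f w * ‖p‖ ^ 2 := by
  have key : ∀ t : ℝ, 0 ≤ (β / 2 * ‖p‖ ^ 2) * (t * t) + (‖p‖ ^ 2) * t + f w := by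
    intro t
    have h := (hf (w + t • p)).trans (hsmooth (w + t • p))
    rw [add_sub_cancel_left, real_inner_smul_right, real_inner_self_eq_norm_sq, norm_smul,
      mul_pow, Real.norm_eq_abs, sq_abs] at h
    linarith
  have h := discrim_le_zero key
  rw [discrim] at h
  linarith

theorem norm_gradient_sq_le {f : H → ℝ} {β : ℝ} {w p : H} (hβ : 0 ≤ β) (hf : ∀ v, 0 ≤ f v)
    (hsmooth : ∀ v, f v ≤ f w + ⟪p, v - w⟫ + β / 2 * ‖v - w‖ ^ 2) :
    ‖p‖ ^ 2 ≤ 2 * β * f w := by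
  rcases eq_or_ne p 0 with rfl | hp
  · have := mul_nonneg hβ (hf w)
    simp only [norm_zero]
    linarith
  · have hpos : 0 < ‖p‖ ^ 2 := by positivity
    refine le_of_mul_le_mul_right ?_ hpos
    simpa [sq (‖p‖ ^ 2)] using norm_gradient_pow_four_le hf hsmooth

theorem nonneg_of_linear_le_of_le_quadratic {f : H → ℝ} {β : ℝ} {w v p : H} (hne : v ≠ w)
    (hlower : f w + ⟪p, v - w⟫ ≤ f v)
    (hupper : f v ≤ f w + ⟪p, v - w⟫ + β / 2 * ‖v - w‖ ^ 2) : 0 ≤ β := by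
  have hpos : 0 < ‖v - w‖ ^ 2 := by
    have := norm_pos_iff.2 (sub_ne_zero.2 hne)
    positivity
  by_contra! hβ
  nlinarith [mul_neg_of_neg_of_pos hβ hpos]

theorem sum_tuple_succ {M : Type*} [AddCommMonoid M] {n m : ℕ} (F : (Fin (m + 1) → Fin n) → M) :
    ∑ s, F s = ∑ i, ∑ s : Fin m → Fin n, F (Fin.cons i s) := by
  rw [← (Fin.consEquiv fun _ => Fin n).sum_comp, Fintype.sum_prod_type]
  rfl

theorem sum_tuple_sum {n : ℕ} (x : Fin n → H) (m : ℕ) :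
    (n : ℝ) • ∑ s : Fin m → Fin n, ∑ j, x (s j) = ((m : ℝ) * (n : ℝ) ^ m) • ∑ i, x i := by
  induction m with
  | zero => simp
  | succ m ih =>
    rw [sum_tuple_succ]
    simp only [Fin.sum_univ_succ, Fin.cons_zero, Fin.cons_succ, sum_add_distrib, sum_const,
      card_univ, Fintype.card_fun, Fintype.card_fin, ← Nat.cast_smul_eq_nsmul ℝ, ← smul_sum,
      ih, smul_smul, ← add_smul]
    congr 1
    push_cast
    ring

theorem sum_tuple_norm_sum_sq {n : ℕ} (x : Fin n → H) (m : ℕ) :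
    (n : ℝ) ^ 2 * ∑ s : Fin m → Fin n, ‖∑ j, x (s j)‖ ^ 2 =
      (n : ℝ) ^ m * (m * n * ∑ i, ‖x i‖ ^ 2 + m * (m - 1) * ‖∑ i, x i‖ ^ 2) := by
  induction m with
  | zero => simp
  | succ m ih =>
    have hcross : (n : ℝ) * ⟪∑ i, x i, ∑ s : Fin m → Fin n, ∑ j, x (s j)⟫ =
        m * (n : ℝ) ^ m * ‖∑ i, x i‖ ^ 2 := by
      rw [← real_inner_smul_right, sum_tuple_sum, real_inner_smul_right,
        real_inner_self_eq_norm_sq]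
    have hexpand : ∑ s : Fin (m + 1) → Fin n, ‖∑ j, x (s j)‖ ^ 2 =
        (n : ℝ) ^ m * ∑ i, ‖x i‖ ^ 2 +
          2 * ⟪∑ i, x i, ∑ s : Fin m → Fin n, ∑ j, x (s j)⟫ +
          n * ∑ s : Fin m → Fin n, ‖∑ j, x (s j)‖ ^ 2 := by
      rw [sum_tuple_succ, sum_inner]
      simp_rw [inner_sum (𝕜 := ℝ) Finset.univ (fun s : Fin m → Fin n => ∑ j, x (s j))]
      simp only [Fin.sum_univ_succ, Fin.cons_zero, Fin.cons_succ, norm_add_sq_real,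
        sum_add_distrib, sum_const, card_univ, Fintype.card_fun, Fintype.card_fin, nsmul_eq_mul,
        mul_sum, Nat.cast_pow]
    rw [hexpand]
    push_cast
    linear_combination (n : ℝ) * ih + 2 * (n : ℝ) * hcross

theorem average_norm_sub_smul_sum_sq {n : ℕ} (hn : n ≠ 0) (x : Fin n → H) (m : ℕ) (c : ℝ)
    (a : H) :
    (1 / (n : ℝ) ^ m) * ∑ s : Fin m → Fin n, ‖a - c • ∑ j, x (s j)‖ ^ 2 =
      ‖a‖ ^ 2 - 2 * c * m * ⟪(1 / (n : ℝ)) • ∑ i, x i, a⟫ +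
        c ^ 2 * (m * ((1 / (n : ℝ)) * ∑ i, ‖x i‖ ^ 2) +
          m * (m - 1) * ‖(1 / (n : ℝ)) • ∑ i, x i‖ ^ 2) := by
  have hn' : (n : ℝ) ≠ 0 := by exact_mod_cast hn
  have hlin : (n : ℝ) * ⟪a, ∑ s : Fin m → Fin n, ∑ j, x (s j)⟫ =
      m * (n : ℝ) ^ m * ⟪∑ i, x i, a⟫ := by
    rw [← real_inner_smul_right, sum_tuple_sum, real_inner_smul_right, real_inner_comm]
  have hsq := sum_tuple_norm_sum_sq x m
  have hexpand : ∑ s : Fin m → Fin n, ‖a - c • ∑ j, x (s j)‖ ^ 2 =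
      (n : ℝ) ^ m * ‖a‖ ^ 2 - 2 * c * ⟪a, ∑ s : Fin m → Fin n, ∑ j, x (s j)⟫ +
        c ^ 2 * ∑ s : Fin m → Fin n, ‖∑ j, x (s j)‖ ^ 2 := by
    rw [inner_sum (𝕜 := ℝ) Finset.univ (fun s : Fin m → Fin n => ∑ j, x (s j))]
    simp only [norm_sub_sq_real, real_inner_smul_right, norm_smul, mul_pow, Real.norm_eq_abs,
      sq_abs, sum_add_distrib, sum_sub_distrib, sum_const, card_univ, Fintype.card_fun,
      Fintype.card_fin, nsmul_eq_mul, mul_sum, Nat.cast_pow, mul_assoc]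
  rw [hexpand, real_inner_smul_left, norm_smul, mul_pow, Real.norm_eq_abs, sq_abs]
  have hlin' := eq_div_of_mul_eq hn' ((mul_comm _ _).trans hlin)
  have hsq' := eq_div_of_mul_eq (pow_ne_zero 2 hn') ((mul_comm _ _).trans hsq)
  rw [hlin', hsq']
  field_simp

end Averages

/-- In the convex interpolation setting, one step of mini-batch SGD with step size
`η*(m) = m/(β + λ(m−1))` contracts the expected squared distance to the minimizer
by the factor `1 − η*(m)·α`. -/
theorem sgd_interpolation_one_step_contraction
    {H : Type*} [NormedAddCommGroup H] [InnerProductSpace ℝ H] [CompleteSpace H]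
    (n : ℕ) (hn : 1 ≤ n)
    (ℓ : Fin n → H → ℝ) (g : Fin n → H → H)
    (β lam α : ℝ)
    (hgrad : ∀ i w, HasGradientAt (ℓ i) (g i w) w)
    (hnonneg : ∀ i w, 0 ≤ ℓ i w)
    (hconvex : ∀ i w v, ℓ i w + ⟪g i w, v - w⟫ ≤ ℓ i v)
    (hsmooth : ∀ i w v, ℓ i v ≤ ℓ i w + ⟪g i w, v - w⟫ + β / 2 * ‖v - w‖ ^ 2)
    (L : H → ℝ) (hL : ∀ w, L w = (1 / (n : ℝ)) * ∑ i, ℓ i w)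
    (gL : H → H) (hgL : ∀ w, HasGradientAt L (gL w) w)
    (hLsmooth : ∀ w v, L v ≤ L w + ⟪gL w, v - w⟫ + lam / 2 * ‖v - w‖ ^ 2)
    (hLstrong : ∀ w v, L w + ⟪gL w, v - w⟫ + α / 2 * ‖v - w‖ ^ 2 ≤ L v)
    (wstar : H) (hmin : ∀ w, L wstar ≤ L w)
    (hinterp : ∀ i, ℓ i wstar = 0)
    (m : ℕ) (hm : 1 ≤ m)
    (η : ℝ) (hη : η = (m : ℝ) / (β + lam * ((m : ℝ) - 1))) :
    ∀ w : H,
      (1 / (n : ℝ) ^ m) *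
          ∑ s : Fin m → Fin n, ‖(w - (η / (m : ℝ)) • ∑ j, g (s j) w) - wstar‖ ^ 2
        ≤ (1 - η * α) * ‖w - wstar‖ ^ 2 := by
  intro w
  have hn0 : n ≠ 0 := by omega
  have hn' : (0 : ℝ) < n := by exact_mod_cast hn
  have hm' : (1 : ℝ) ≤ m := by exact_mod_cast hm
  rcases eq_or_ne w wstar with rfl | hne
  · have hg : ∀ i, g i w = 0 := by
      intro i
      have h := norm_gradient_pow_four_le (hnonneg i) (hsmooth i w)
      rw [hinterp i, mul_zero, zero_mul] at h
      simpa using le_antisymm h (by positivity)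
    simp [hg]
  have hgL_eq : gL w = (1 / (n : ℝ)) • ∑ i, g i w := by
    refine (hgL w).unique ?_
    have h : HasFDerivAt (fun v => (1 / (n : ℝ)) • ∑ i, ℓ i v) _ w :=
      (HasFDerivAt.fun_sum fun i _ => (hgrad i w).hasFDerivAt).const_smul (1 / (n : ℝ))
    rw [hasGradientAt_iff_hasFDerivAt, funext hL, map_smul, map_sum]
    exact h
  have hβ : 0 ≤ β :=
    nonneg_of_linear_le_of_le_quadratic hne.symm (hconvex ⟨0, hn⟩ w wstar)
      (hsmooth ⟨0, hn⟩ w wstar)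
  have hLconvex : L w + ⟪gL w, wstar - w⟫ ≤ L wstar := by
    rw [hL w, hL wstar, hgL_eq, real_inner_smul_left, sum_inner, ← mul_add, ← sum_add_distrib]
    gcongr with i
    exact hconvex i w wstar
  have hlam : 0 ≤ lam := nonneg_of_linear_le_of_le_quadratic hne.symm hLconvex (hLsmooth w wstar)
  have hLnonneg : ∀ v, 0 ≤ L v := by
    intro v
    rw [hL v]
    exact mul_nonneg (by positivity) (sum_nonneg fun i _ => hnonneg i v)
  have hLstar : L wstar = 0 := by simp [hL, hinterp]
  have hvar : (1 / (n : ℝ)) * ∑ i, ‖g i w‖ ^ 2 ≤ 2 * β * L w := by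
    calc (1 / (n : ℝ)) * ∑ i, ‖g i w‖ ^ 2 ≤ (1 / (n : ℝ)) * ∑ i, 2 * β * ℓ i w := by
          gcongr with i
          exact norm_gradient_sq_le hβ (hnonneg i) (hsmooth i w)
      _ = 2 * β * L w := by rw [hL w, ← mul_sum]; ring
  have hmean : ‖gL w‖ ^ 2 ≤ 2 * lam * L w := norm_gradient_sq_le hlam hLnonneg (hLsmooth w)
  have hinner : L w + α / 2 * ‖w - wstar‖ ^ 2 ≤ ⟪gL w, w - wstar⟫ := by
    have h := hLstrong w wstar
    rw [hLstar, ← neg_sub w wstar, inner_neg_right, norm_neg] at h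
    linarith
  have hD : 0 ≤ β + lam * ((m : ℝ) - 1) := add_nonneg hβ (mul_nonneg hlam (by linarith))
  have hη0 : 0 ≤ η := by rw [hη]; positivity
  have hηD : η ^ 2 * (β + lam * ((m : ℝ) - 1)) = η * m := by
    rcases hD.eq_or_lt with h0 | hpos
    · rw [hη, ← h0]
      simp
    · rw [sq, mul_assoc, hη, div_mul_cancel₀ _ hpos.ne']
  simp_rw [sub_right_comm w _ wstar]
  rw [average_norm_sub_smul_sum_sq hn0 (fun i => g i w), ← hgL_eq]
  have hnoise : (η / m) ^ 2 * (m * ((1 / (n : ℝ)) * ∑ i, ‖g i w‖ ^ 2) +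
      m * (m - 1) * ‖gL w‖ ^ 2) ≤ 2 * η * L w := by
    have hm1 : 0 ≤ (m : ℝ) - 1 := by linarith
    calc _ ≤ (η / m) ^ 2 * (m * (2 * β * L w) + m * (m - 1) * (2 * lam * L w)) := by gcongr
      _ = 2 * L w / m * (η ^ 2 * (β + lam * ((m : ℝ) - 1))) := by field_simp
      _ = 2 * η * L w := by rw [hηD]; field_simp
  have hstep : 2 * (η / m) * m = 2 * η := by field_simp
  rw [hstep]
  linarith [mul_le_mul_of_nonneg_left hinner hη0]
end

section
/- Let x₁,…,x_n ∈ ℝ^d with ‖xᵢ‖² ≤ β for all i, and H = (1/n)∑_{i=1}^n xᵢxᵢᵀ. Then the matrix (β/m)·H + ((m−1)/m)·H² − E[H_m²] is positive semidefinite, where E[H_m²] is the average of ((1/m)∑_{j=1}^m x_{i_j}x_{i_j}ᵀ)² over all m-tuples (i₁,…,i_m) ∈ {1,…,n}^m. -/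
open Finset Matrix

/-- Summing the first moment of an `m`-fold sum over all index tuples. -/
theorem sum_tuple_sum_s6 {ι R : Type*} [Fintype ι] [Nonempty ι] [Ring R] [Algebra ℝ R]
    (A : ι → R) (m : ℕ) :
    ∑ s : Fin m → ι, ∑ j, A (s j) =
      ((Fintype.card ι : ℝ) ^ m * (m / Fintype.card ι)) • ∑ i, A i := by
  have hc : (Fintype.card ι : ℝ) ≠ 0 := by exact_mod_cast Fintype.card_ne_zero
  induction m with
  | zero => simp
  | succ m ih =>
    rw [← (Fin.consEquiv fun _ => ι).sum_comp, Fintype.sum_prod_type]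
    simp only [Fin.consEquiv_apply, Fin.sum_univ_succ, Fin.cons_zero, Fin.cons_succ,
      sum_add_distrib, ih, sum_const, card_univ, Fintype.card_fun, Fintype.card_fin,
      ← Nat.cast_smul_eq_nsmul ℝ, ← smul_sum]
    push_cast
    match_scalars
    field_simp
    ring

/-- Summing the second moment of an `m`-fold sum over all index tuples. -/
theorem sum_tuple_sum_sq {ι R : Type*} [Fintype ι] [Nonempty ι] [Ring R] [Algebra ℝ R]
    (A : ι → R) (m : ℕ) :
    ∑ s : Fin m → ι, (∑ j, A (s j)) ^ 2 =
      (Fintype.card ι : ℝ) ^ m • ((m / Fintype.card ι : ℝ) • ∑ i, A i ^ 2 +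
        ((m : ℝ) * (m - 1) / (Fintype.card ι : ℝ) ^ 2) • (∑ i, A i) ^ 2) := by
  have hc : (Fintype.card ι : ℝ) ≠ 0 := by exact_mod_cast Fintype.card_ne_zero
  induction m with
  | zero => simp
  | succ m ih =>
    have expand (a b : R) : (a + b) ^ 2 = a ^ 2 + a * b + b * a + b ^ 2 := by noncomm_ring
    rw [← (Fin.consEquiv fun _ => ι).sum_comp, Fintype.sum_prod_type]
    simp only [Fin.consEquiv_apply, Fin.sum_univ_succ, Fin.cons_zero, Fin.cons_succ, expand,
      sum_add_distrib, ih, sum_const, card_univ, Fintype.card_fun, Fintype.card_fin,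
      ← Nat.cast_smul_eq_nsmul ℝ, ← smul_sum, ← mul_sum, ← sum_mul, sum_tuple_sum_s6,
      mul_smul_comm, smul_mul_assoc, ← pow_two]
    push_cast
    match_scalars <;> field_simp <;> ring

/-- If `‖xᵢ‖² ≤ β` for all `i`, then `(β/m)·H + ((m−1)/m)·H² − E[H_m²]` is positive
semidefinite, where `E[H_m²]` is the average of the squared subsample covariance over
all `n^m` equally likely index tuples. -/
theorem subsample_covariance_second_moment_bound
    (d n : ℕ) (hn : 1 ≤ n) (x : Fin n → Fin d → ℝ)
    (β : ℝ) (hβ : ∀ i, (∑ a, x i a ^ 2) ≤ β)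
    (H : Matrix (Fin d) (Fin d) ℝ)
    (hH : H = (1 / (n : ℝ)) • ∑ i, Matrix.vecMulVec (x i) (x i))
    (m : ℕ) (hm : 1 ≤ m) :
    ((β / (m : ℝ)) • H + (((m : ℝ) - 1) / (m : ℝ)) • H ^ 2
        - (1 / (n : ℝ) ^ m) •
            ∑ s : Fin m → Fin n,
              ((1 / (m : ℝ)) • ∑ j, Matrix.vecMulVec (x (s j)) (x (s j))) ^ 2).PosSemidef := by
  have : NeZero n := ⟨by omega⟩
  have hn0 : (n : ℝ) ≠ 0 := by exact_mod_cast (by omega : n ≠ 0)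
  have hm0 : (m : ℝ) ≠ 0 := by exact_mod_cast (by omega : m ≠ 0)
  have hsq (i : Fin n) : vecMulVec (x i) (x i) ^ 2 =
      (∑ a, x i a ^ 2) • vecMulVec (x i) (x i) := by
    rw [pow_two, vecMulVec_mul_vecMulVec, vecMulVec_smul]
    simp [dotProduct, pow_two]
  have key : (β / (m : ℝ)) • H + (((m : ℝ) - 1) / (m : ℝ)) • H ^ 2
        - (1 / (n : ℝ) ^ m) •
            ∑ s : Fin m → Fin n,
              ((1 / (m : ℝ)) • ∑ j, vecMulVec (x (s j)) (x (s j))) ^ 2 =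
      (1 / ((m : ℝ) * n)) • ∑ i, (β - ∑ a, x i a ^ 2) • vecMulVec (x i) (x i) := by
    simp only [smul_pow, ← smul_sum, sum_tuple_sum_sq fun i => vecMulVec (x i) (x i), hH,
      sub_smul, sum_sub_distrib, ← hsq, Fintype.card_fin]
    match_scalars <;> field_simp
    ring
  rw [key]
  refine (posSemidef_sum _ fun i _ => ?_).smul (by positivity)
  refine PosSemidef.smul ?_ (sub_nonneg.2 (hβ i))
  simpa using posSemidef_vecMulVec_self_star (x i)
end

section
/- In the quadratic interpolation setting, for every batch size m ≥ 1, every step size η with 0 < η < 2m/(β + (m−1)λ₁), and every t ≥ 1, mini-batch SGD satisfies E[L(w_t)] ≤ λ₁·E‖P(w_t − w*)‖² ≤ λ₁·g(m, η)^t·‖P(w₀ − w*)‖². -/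
open RealInnerProductSpace Finset

/-- The rank-one operator `u ↦ ⟪v, u⟫ v`. -/
noncomputable def rankOne {d : ℕ} (v : EuclideanSpace ℝ (Fin d)) :
    EuclideanSpace ℝ (Fin d) →ₗ[ℝ] EuclideanSpace ℝ (Fin d) where
  toFun u := ⟪v, u⟫ • v
  map_add' a b := by simp [inner_add_right, add_smul]
  map_smul' c a := by simp [inner_smul_right, mul_smul]

/-- The sample covariance operator `H = (1/n) ∑ᵢ xᵢxᵢᵀ` as a linear map. -/
noncomputable def covOp {n d : ℕ} (x : Fin n → EuclideanSpace ℝ (Fin d)) :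
    EuclideanSpace ℝ (Fin d) →ₗ[ℝ] EuclideanSpace ℝ (Fin d) :=
  (1 / (n : ℝ)) • ∑ i, rankOne (x i)

section Sampling

variable {E : Type*} [NormedAddCommGroup E] [InnerProductSpace ℝ E]

/-- Second moment of `u` plus a sum of `m` independent uniform draws from the family `a`. -/
lemma mean_norm_sq_add_sum_draws {n : ℕ} (hn : 1 ≤ n) (a : Fin n → E) (m : ℕ) (u : E) :
    (1 / (n : ℝ) ^ m) * ∑ s : Fin m → Fin n, ‖u + ∑ j, a (s j)‖ ^ 2
      = ‖u‖ ^ 2 + 2 * m * ⟪u, (1 / (n : ℝ)) • ∑ i, a i⟫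
        + m * ((1 / (n : ℝ)) * ∑ i, ‖a i‖ ^ 2)
        + m * (m - 1) * ‖(1 / (n : ℝ)) • ∑ i, a i‖ ^ 2 := by
  have hn0 : (n : ℝ) ≠ 0 := by positivity
  induction m generalizing u with
  | zero => simp
  | succ m ih =>
    have hsum : ∑ s : Fin (m + 1) → Fin n, ‖u + ∑ j, a (s j)‖ ^ 2
        = ∑ i, ∑ s : Fin m → Fin n, ‖(u + a i) + ∑ j, a (s j)‖ ^ 2 := by
      rw [← Fintype.sum_prod_type', ← (Fin.consEquiv fun _ => Fin n).sum_comp]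
      refine Finset.sum_congr rfl fun p _ => ?_
      simp [Fin.consEquiv, Fin.sum_univ_succ, add_assoc]
    set μ := (1 / (n : ℝ)) • ∑ i, a i with hμ
    have hμsum (v : E) : ∑ i, ⟪v, a i⟫ = n * ⟪v, μ⟫ := by
      rw [hμ, inner_smul_right, inner_sum]
      field_simp
    have hμsum' : ∑ i, ⟪a i, μ⟫ = n * ‖μ‖ ^ 2 := by
      rw [← real_inner_self_eq_norm_sq, ← hμsum]
      exact Finset.sum_congr rfl fun i _ => real_inner_comm _ _
    have hsplit : (1 / (n : ℝ) ^ (m + 1)) * ∑ s : Fin (m + 1) → Fin n, ‖u + ∑ j, a (s j)‖ ^ 2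
        = (1 / (n : ℝ)) * ∑ i, (1 / (n : ℝ) ^ m) *
            ∑ s : Fin m → Fin n, ‖(u + a i) + ∑ j, a (s j)‖ ^ 2 := by
      rw [hsum, ← Finset.mul_sum, ← mul_assoc, one_div_mul_one_div, pow_succ']
    rw [hsplit]
    simp only [ih]
    simp only [norm_add_sq_real, inner_add_left, mul_add, Finset.sum_add_distrib,
      ← Finset.mul_sum, hμsum, hμsum', Finset.sum_const, Finset.card_univ, Fintype.card_fin,
      nsmul_eq_mul]
    push_cast
    field_simp
    ring

end Sampling

section Expectation

variable {H : Type*} {n m : ℕ} {step : (Fin m → Fin n) → H → H}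

lemma sgdExp_mono {φ ψ : H → ℝ} (h : ∀ w, φ w ≤ ψ w) (t : ℕ) (w : H) :
    sgdExp n m step φ t w ≤ sgdExp n m step ψ t w := by
  induction t generalizing w with
  | zero => exact h w
  | succ t ih =>
    simp only [sgdExp]
    gcongr
    exact ih _

lemma sgdExp_const_mul (c : ℝ) (φ : H → ℝ) (t : ℕ) (w : H) :
    sgdExp n m step (fun w => c * φ w) t w = c * sgdExp n m step φ t w := by
  induction t generalizing w with
  | zero => rfl
  | succ t ih =>
    simp only [sgdExp, ih, ← Finset.mul_sum]
    ring

/-- A one-step contraction of the mean of `φ` by a factor `G` iterates. -/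
lemma sgdExp_le_pow_mul {φ : H → ℝ} {G : ℝ} (hG : 0 ≤ G)
    (h : ∀ w, (1 / (n : ℝ) ^ m) * ∑ s, φ (step s w) ≤ G * φ w) (t : ℕ) (w : H) :
    sgdExp n m step φ t w ≤ G ^ t * φ w := by
  induction t generalizing w with
  | zero => simp [sgdExp]
  | succ t ih =>
    calc (1 / (n : ℝ) ^ m) * ∑ s, sgdExp n m step φ t (step s w)
        ≤ (1 / (n : ℝ) ^ m) * ∑ s, G ^ t * φ (step s w) := by
          gcongr
          exact ih _
      _ = G ^ t * ((1 / (n : ℝ) ^ m) * ∑ s, φ (step s w)) := by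
          rw [← Finset.mul_sum]
          ring
      _ ≤ G ^ t * (G * φ w) := by exact mul_le_mul_of_nonneg_left (h w) (pow_nonneg hG t)
      _ = G ^ (t + 1) * φ w := by ring

end Expectation

section Covariance

variable {n d : ℕ} (x : Fin n → EuclideanSpace ℝ (Fin d))

lemma covOp_apply (u : EuclideanSpace ℝ (Fin d)) :
    covOp x u = (1 / (n : ℝ)) • ∑ i, ⟪x i, u⟫ • x i := by
  simp [covOp, rankOne, LinearMap.sum_apply]

lemma inner_covOp (u v : EuclideanSpace ℝ (Fin d)) :
    ⟪u, covOp x v⟫ = (1 / (n : ℝ)) * ∑ i, ⟪x i, u⟫ * ⟪x i, v⟫ := by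
  rw [covOp_apply, inner_smul_right, inner_sum]
  congr 1
  refine Finset.sum_congr rfl fun i _ => ?_
  rw [inner_smul_right, real_inner_comm (x i) u, mul_comm]

lemma inner_covOp_comm (u v : EuclideanSpace ℝ (Fin d)) :
    ⟪u, covOp x v⟫ = ⟪covOp x u, v⟫ := by
  rw [real_inner_comm v, inner_covOp, inner_covOp]
  simp only [mul_comm]

lemma inner_eq_zero_of_mem_range_covOp_orthogonal (hn : 1 ≤ n) {u : EuclideanSpace ℝ (Fin d)}
    (hu : u ∈ (LinearMap.range (covOp x))ᗮ) (i : Fin n) : ⟪x i, u⟫ = 0 := by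
  have h : ⟪covOp x u, u⟫ = 0 := (Submodule.mem_orthogonal _ _).1 hu _ ⟨u, rfl⟩
  rw [real_inner_comm, inner_covOp] at h
  have hn0 : (n : ℝ) ≠ 0 := by positivity
  have hsum : ∑ i, ⟪x i, u⟫ * ⟪x i, u⟫ = 0 := by simpa [hn0] using h
  have := (Finset.sum_eq_zero_iff_of_nonneg fun i _ => mul_self_nonneg _).1 hsum i (mem_univ i)
  simpa using this

lemma mem_range_covOp (hn : 1 ≤ n) (i : Fin n) : x i ∈ LinearMap.range (covOp x) := by
  rw [← Submodule.orthogonal_orthogonal (LinearMap.range (covOp x)), Submodule.mem_orthogonal]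
  intro u hu
  rw [real_inner_comm]
  exact inner_eq_zero_of_mem_range_covOp_orthogonal x hn hu i

/-- Mean squared norm after one mini-batch step from `u`. -/
lemma mean_norm_sq_step_le (hn : 1 ≤ n) {β : ℝ} (hβ : ∀ i, ‖x i‖ ^ 2 ≤ β)
    {m : ℕ} (hm : 1 ≤ m) (η : ℝ) (u : EuclideanSpace ℝ (Fin d)) :
    (1 / (n : ℝ) ^ m) * ∑ s : Fin m → Fin n,
        ‖u - η • ((1 / (m : ℝ)) • ∑ j, ⟪x (s j), u⟫ • x (s j))‖ ^ 2
      ≤ ‖u‖ ^ 2 - 2 * η * ⟪u, covOp x u⟫ + η ^ 2 * β / m * ⟪u, covOp x u⟫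
        + η ^ 2 * (m - 1) / m * ‖covOp x u‖ ^ 2 := by
  have hm0 : (m : ℝ) ≠ 0 := by positivity
  have hmean : (1 / (n : ℝ)) • ∑ i, (-(η / m)) • ⟪x i, u⟫ • x i = (-(η / m)) • covOp x u := by
    rw [covOp_apply, ← Finset.smul_sum, smul_comm]
  have hsq : (1 / (n : ℝ)) * ∑ i, ‖(-(η / m)) • ⟪x i, u⟫ • x i‖ ^ 2
      ≤ (η / m) ^ 2 * (β * ⟪u, covOp x u⟫) := by
    rw [inner_covOp, mul_left_comm β, mul_left_comm _ (1 / (n : ℝ))]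
    refine mul_le_mul_of_nonneg_left ?_ (by positivity)
    rw [Finset.mul_sum, Finset.mul_sum]
    refine Finset.sum_le_sum fun i _ => ?_
    simp only [norm_smul, mul_pow, Real.norm_eq_abs, sq_abs, neg_sq]
    rw [mul_comm β, ← sq]
    gcongr
    exact hβ i
  have hstep (s : Fin m → Fin n) : u - η • ((1 / (m : ℝ)) • ∑ j, ⟪x (s j), u⟫ • x (s j))
      = u + ∑ j, (-(η / m)) • ⟪x (s j), u⟫ • x (s j) := by
    rw [← Finset.smul_sum, smul_smul, neg_smul, sub_eq_add_neg, mul_one_div]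
  simp only [hstep]
  rw [mean_norm_sq_add_sum_draws hn (fun i => (-(η / m)) • ⟪x i, u⟫ • x i), hmean,
    inner_smul_right, norm_smul, mul_pow, Real.norm_eq_abs, sq_abs]
  refine (add_le_add_left (add_le_add_right
    (mul_le_mul_of_nonneg_left hsq (Nat.cast_nonneg m)) _) _).trans_eq ?_
  field_simp
  ring

variable {x}

lemma inner_eigenvector_covOp {e : EuclideanSpace ℝ (Fin d)} {l : ℝ} (he : covOp x e = l • e)
    (u : EuclideanSpace ℝ (Fin d)) : ⟪e, covOp x u⟫ = l * ⟪e, u⟫ := by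
  rw [inner_covOp_comm, he, real_inner_smul_left]

lemma norm_sq_eq_sum_inner_sq (e : OrthonormalBasis (Fin d) ℝ (EuclideanSpace ℝ (Fin d)))
    (u : EuclideanSpace ℝ (Fin d)) : ‖u‖ ^ 2 = ∑ i, ⟪e i, u⟫ ^ 2 := by
  simpa using (e.sum_sq_norm_inner_right u).symm

lemma inner_covOp_self_eq_sum {e : OrthonormalBasis (Fin d) ℝ (EuclideanSpace ℝ (Fin d))}
    {lam : Fin d → ℝ} (heig : ∀ i, covOp x (e i) = lam i • e i) (u : EuclideanSpace ℝ (Fin d)) :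
    ⟪u, covOp x u⟫ = ∑ i, lam i * ⟪e i, u⟫ ^ 2 := by
  rw [← e.sum_inner_mul_inner]
  refine Finset.sum_congr rfl fun i _ => ?_
  rw [inner_eigenvector_covOp (heig i), real_inner_comm]
  ring

lemma norm_sq_covOp_eq_sum {e : OrthonormalBasis (Fin d) ℝ (EuclideanSpace ℝ (Fin d))}
    {lam : Fin d → ℝ} (heig : ∀ i, covOp x (e i) = lam i • e i) (u : EuclideanSpace ℝ (Fin d)) :
    ‖covOp x u‖ ^ 2 = ∑ i, lam i ^ 2 * ⟪e i, u⟫ ^ 2 := by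
  simp only [norm_sq_eq_sum_inner_sq e, inner_eigenvector_covOp (heig _), mul_pow]

end Covariance

/-- In the quadratic interpolation setting, for step size `0 < η < 2m/(β + (m−1)λ₁)`,
mini-batch SGD satisfies
`E[L(w_t)] ≤ λ₁·E‖P(w_t − w*)‖² ≤ λ₁·g(m,η)^t·‖P(w₀ − w*)‖²` for all `t ≥ 1`,
where `g(m,η) = max_{λ ∈ [λ_k, λ₁]} (1 − ηλ)² + (η²λ/m)(β − λ)`. -/
theorem quadratic_sgd_upper_bound
    (d n : ℕ) (hn : 1 ≤ n)
    (x : Fin n → EuclideanSpace ℝ (Fin d)) (y : Fin n → ℝ)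
    (β : ℝ) (hβ : ∀ i, ‖x i‖ ^ 2 ≤ β)
    (wstar : EuclideanSpace ℝ (Fin d)) (hinterp : ∀ i, ⟪wstar, x i⟫ = y i)
    (L : EuclideanSpace ℝ (Fin d) → ℝ)
    (hL : ∀ w, L w = (1 / (n : ℝ)) * ∑ i, (⟪w, x i⟫ - y i) ^ 2)
    -- eigendecomposition of H = covOp x, with eigenvalues λ₁ ≥ ⋯ ≥ λ_k > 0 = ⋯ = λ_d
    (k : ℕ) (hk1 : 1 ≤ k) (hkd : k ≤ d)
    (e : OrthonormalBasis (Fin d) ℝ (EuclideanSpace ℝ (Fin d)))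
    (lam : Fin d → ℝ)
    (heig : ∀ i, covOp x (e i) = lam i • e i)
    (hmono : ∀ i j : Fin d, i ≤ j → lam j ≤ lam i)
    (hpos : ∀ i : Fin d, (i : ℕ) < k → 0 < lam i)
    (hzero : ∀ i : Fin d, k ≤ (i : ℕ) → lam i = 0)
    (lam1 lamk : ℝ)
    (hlam1 : lam1 = lam ⟨0, by omega⟩)
    (hlamk : lamk = lam ⟨k - 1, by omega⟩)
    -- P is the orthogonal projection onto Range(H)
    (P : EuclideanSpace ℝ (Fin d) → EuclideanSpace ℝ (Fin d))
    (hPmem : ∀ u, P u ∈ LinearMap.range (covOp x))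
    (hPorth : ∀ u, u - P u ∈ (LinearMap.range (covOp x))ᗮ)
    -- mini-batch SGD
    (m : ℕ) (hm : 1 ≤ m)
    (η : ℝ) (hη0 : 0 < η) (hη1 : η < 2 * (m : ℝ) / (β + ((m : ℝ) - 1) * lam1))
    (step : (Fin m → Fin n) → EuclideanSpace ℝ (Fin d) → EuclideanSpace ℝ (Fin d))
    (hstep : ∀ s w, step s w
      = w - η • ((1 / (m : ℝ)) • ∑ j, ⟪x (s j), w - wstar⟫ • x (s j)))
    (w0 : EuclideanSpace ℝ (Fin d)) :
    ∀ t : ℕ, 1 ≤ t →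
      sgdExp n m step L t w0
          ≤ lam1 * sgdExp n m step (fun w => ‖P (w - wstar)‖ ^ 2) t w0
      ∧ lam1 * sgdExp n m step (fun w => ‖P (w - wstar)‖ ^ 2) t w0
          ≤ lam1 *
              (sSup ((fun l => (1 - η * l) ^ 2 + η ^ 2 * l / (m : ℝ) * (β - l)) ''
                Set.Icc lamk lam1)) ^ t * ‖P (w0 - wstar)‖ ^ 2 := by
  have hm0 : (m : ℝ) ≠ 0 := by positivity
  set g : ℝ → ℝ := fun l => (1 - η * l) ^ 2 + η ^ 2 * l / (m : ℝ) * (β - l) with hg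
  set G := sSup (g '' Set.Icc lamk lam1)
  have hgcont : Continuous g := by fun_prop
  have hle1 (i : Fin d) : lam i ≤ lam1 := hlam1 ▸ hmono _ _ (Nat.zero_le _)
  have hlam1pos : 0 < lam1 := hlam1 ▸ hpos _ (by simp; omega)
  have hgle (i : Fin d) (hi : (i : ℕ) < k) : g (lam i) ≤ G :=
    le_csSup (isCompact_Icc.image hgcont).bddAbove
      ⟨lam i, ⟨hlamk ▸ hmono _ _ (Fin.le_def.2 (by simp; omega)), hle1 i⟩, rfl⟩
  have hcontract (u) (hu : u ∈ LinearMap.range (covOp x)) :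
      (1 / (n : ℝ) ^ m) * ∑ s : Fin m → Fin n,
        ‖u - η • ((1 / (m : ℝ)) • ∑ j, ⟪x (s j), u⟫ • x (s j))‖ ^ 2 ≤ G * ‖u‖ ^ 2 := by
    refine (mean_norm_sq_step_le x hn hβ hm η u).trans ?_
    rw [inner_covOp_self_eq_sum heig, norm_sq_covOp_eq_sum heig, norm_sq_eq_sum_inner_sq e]
    simp only [Finset.mul_sum, ← Finset.sum_sub_distrib, ← Finset.sum_add_distrib]
    refine Finset.sum_le_sum fun i _ => ?_
    rcases lt_or_ge (i : ℕ) k with hi | hi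
    · refine le_of_eq_of_le ?_ (mul_le_mul_of_nonneg_right (hgle i hi) (sq_nonneg ⟪e i, u⟫))
      simp only [hg]
      field_simp
      ring
    · obtain ⟨z, rfl⟩ := hu
      simp [inner_eigenvector_covOp (heig i), hzero i hi]
  have hG : 0 ≤ G := by
    set i₀ : Fin d := ⟨0, by omega⟩
    have hmem : e i₀ ∈ LinearMap.range (covOp x) :=
      ⟨lam1⁻¹ • e i₀, by rw [map_smul, heig, ← hlam1, inv_smul_smul₀ hlam1pos.ne']⟩
    have h := hcontract _ hmem
    rw [e.norm_eq_one, one_pow, mul_one] at h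
    exact le_trans (by positivity) h
  have hinner (u) (i : Fin n) : ⟪x i, u⟫ = ⟪x i, P u⟫ := by
    rw [← sub_eq_zero, ← inner_sub_right]
    exact inner_eq_zero_of_mem_range_covOp_orthogonal x hn (hPorth u) i
  have hPstep (s : Fin m → Fin n) (w) : P (step s w - wstar)
      = P (w - wstar)
        - η • ((1 / (m : ℝ)) • ∑ j, ⟪x (s j), P (w - wstar)⟫ • x (s j)) := by
    have hP (u) : P u = (LinearMap.range (covOp x)).starProjection u :=
      (Submodule.eq_starProjection_of_mem_orthogonal (hPmem u) (hPorth u)).symm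
    have hPx (i : Fin n) : (LinearMap.range (covOp x)).starProjection (x i) = x i :=
      Submodule.starProjection_eq_self_iff.2 (mem_range_covOp x hn i)
    simp only [← hinner]
    rw [hstep, sub_right_comm, hP, hP, map_sub]
    simp only [map_smul, map_sum, hPx]
  have hLle (w) : L w ≤ lam1 * ‖P (w - wstar)‖ ^ 2 := by
    have hLeq : L w = ⟪P (w - wstar), covOp x (P (w - wstar))⟫ := by
      rw [hL, inner_covOp]
      congr 1
      refine Finset.sum_congr rfl fun i _ => ?_
      rw [← hinner, ← hinterp, ← inner_sub_left, real_inner_comm, sq]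
    rw [hLeq, inner_covOp_self_eq_sum heig, norm_sq_eq_sum_inner_sq e, Finset.mul_sum]
    gcongr with i
    exact hle1 i
  intro t _
  constructor
  · rw [← sgdExp_const_mul]
    exact sgdExp_mono hLle t w0
  · rw [mul_assoc]
    gcongr
    refine sgdExp_le_pow_mul (φ := fun w => ‖P (w - wstar)‖ ^ 2) hG (fun w => ?_) t w0
    simp only [hPstep]
    exact hcontract _ (hPmem _)
end

section
/- In the rate-function setting: (i) for every η ∈ ℝ and every λ ∈ [λ_k, λ₁], g(λ; m, η) ≤ max(gᴵ(m, η), gᴵᴵ(m, η)); and (ii) if λ₁ > λ_k and η > 0, then gᴵ(m, η) ≥ gᴵᴵ(m, η) if and only if η ≤ η₀(m). -/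
/-- The rate function `g(λ; m, η) = (1 − ηλ)² + (η²λ/m)(β − λ)`. -/
noncomputable def gq (β : ℝ) (m : ℕ) (l η : ℝ) : ℝ :=
  (1 - η * l) ^ 2 + η ^ 2 * l / (m : ℝ) * (β - l)

/-- `η₀(m) = 2m/(β + (m−1)(λ₁ + λ_k))`. -/
noncomputable def eta0 (β lam1 lamk : ℝ) (m : ℕ) : ℝ :=
  2 * (m : ℝ) / (β + ((m : ℝ) - 1) * (lam1 + lamk))

theorem gq_sub_gq (β a b η : ℝ) {m : ℕ} (hm : 1 ≤ m) :
    gq β m a η - gq β m b η =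
      η * (a - b) / m * (η * (β + ((m : ℝ) - 1) * (a + b)) - 2 * m) := by
  have : (m : ℝ) ≠ 0 := by positivity
  unfold gq
  field_simp
  ring

theorem convexOn_gq (β η : ℝ) {m : ℕ} (hm : 1 ≤ m) :
    ConvexOn ℝ Set.univ fun l => gq β m l η := by
  refine ⟨convex_univ, fun x _ y _ a b ha hb hab => ?_⟩
  have hm' : (1 : ℝ) ≤ m := by exact_mod_cast hm
  have hgap : 0 ≤ a * b * (((m : ℝ) - 1) / m) * (η * (x - y)) ^ 2 := by
    have := sub_nonneg.2 hm'
    positivity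
  have key : a * gq β m x η + b * gq β m y η - gq β m (a * x + b * y) η =
      a * b * (((m : ℝ) - 1) / m) * (η * (x - y)) ^ 2 := by
    obtain rfl : b = 1 - a := by linarith
    unfold gq
    field_simp
    ring
  simp only [smul_eq_mul]
  linarith

/-- (i) For every `η` and every `λ ∈ [λ_k, λ₁]`,
`g(λ; m, η) ≤ max(gᴵ(m, η), gᴵᴵ(m, η))`; (ii) if `λ₁ > λ_k` and `η > 0`, then
`gᴵ(m, η) ≥ gᴵᴵ(m, η)` iff `η ≤ η₀(m)`. -/
theorem rate_max_at_endpoints_and_crossover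
    (β lam1 lamk : ℝ) (hβ : lam1 < β) (h1k : lamk ≤ lam1) (hk : 0 < lamk)
    (m : ℕ) (hm : 1 ≤ m) :
    (∀ η : ℝ, ∀ l ∈ Set.Icc lamk lam1,
        gq β m l η ≤ max (gq β m lamk η) (gq β m lam1 η))
    ∧ (lamk < lam1 → ∀ η : ℝ, 0 < η →
        (gq β m lam1 η ≤ gq β m lamk η ↔ η ≤ eta0 β lam1 lamk m)) := by
  have hm' : (1 : ℝ) ≤ m := by exact_mod_cast hm
  refine ⟨fun η l hl => (convexOn_gq β η hm).le_max_of_mem_Icc trivial trivial hl,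
    fun hlt η hη => ?_⟩
  have hD : 0 < β + ((m : ℝ) - 1) * (lam1 + lamk) := by
    have := mul_nonneg (sub_nonneg.2 hm') (by linarith : 0 ≤ lam1 + lamk)
    linarith
  have hc : 0 < η * (lam1 - lamk) / m :=
    div_pos (mul_pos hη (sub_pos.2 hlt)) (by linarith)
  rw [← sub_nonpos, gq_sub_gq β lam1 lamk η hm, ← not_lt, mul_pos_iff_of_pos_left hc,
    not_lt, sub_nonpos, eta0, le_div_iff₀ hD]
end

section
/- In the rate-function setting, let ηᴵ(m) = min(η₀(m), m/(β + (m−1)λ_k)). Then for every η with 0 < η ≤ η₀(m), gᴵ(m, ηᴵ(m)) ≤ gᴵ(m, η); moreover gᴵ(m, ηᴵ(m)) = 1 − mλ_k/(β + (m−1)λ_k) if m ≤ β/(λ₁ − λ_k) + 1 (and whenever λ₁ = λ_k), and gᴵ(m, ηᴵ(m)) = 1 − 4m(m−1)λ₁λ_k/(β + (m−1)(λ₁ + λ_k))² if λ₁ > λ_k and m > β/(λ₁ − λ_k) + 1. -/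
/-- Completing the square in `η` for the rate function. -/
theorem gq_eq_add_sq {β l : ℝ} {m : ℕ} (hm : (m : ℝ) ≠ 0)
    (hD : β + ((m : ℝ) - 1) * l ≠ 0) (η : ℝ) :
    gq β m l η = 1 - (m : ℝ) * l / (β + ((m : ℝ) - 1) * l)
      + l * (β + ((m : ℝ) - 1) * l) / m * (η - m / (β + ((m : ℝ) - 1) * l)) ^ 2 := by
  obtain ⟨D, hβ⟩ : ∃ D, D = β + ((m : ℝ) - 1) * l := ⟨_, rfl⟩
  obtain rfl : β = D - ((m : ℝ) - 1) * l := by linarith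
  rw [← hβ] at hD ⊢
  unfold gq
  field_simp
  ring

/-- The value of the rate function `g(λ_k; m, ·)` at `η₀(m)`. -/
theorem gq_eta0 {β lam1 lamk : ℝ} {m : ℕ}
    (hE : β + ((m : ℝ) - 1) * (lam1 + lamk) ≠ 0) :
    gq β m lamk (eta0 β lam1 lamk m) = 1 - 4 * (m : ℝ) * ((m : ℝ) - 1) * lam1 * lamk
      / (β + ((m : ℝ) - 1) * (lam1 + lamk)) ^ 2 := by
  unfold gq eta0
  field_simp
  ring

/-- The unconstrained minimizer of `g(λ_k; m, ·)` is at most `η₀(m)` exactly when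
`(m − 1)(λ₁ − λ_k) ≤ β`. -/
theorem div_le_eta0_iff {β lam1 lamk : ℝ} {m : ℕ} (hm : 0 < (m : ℝ))
    (hD : 0 < β + ((m : ℝ) - 1) * lamk) (hE : 0 < β + ((m : ℝ) - 1) * (lam1 + lamk)) :
    (m : ℝ) / (β + ((m : ℝ) - 1) * lamk) ≤ eta0 β lam1 lamk m
      ↔ ((m : ℝ) - 1) * (lam1 - lamk) ≤ β := by
  rw [eta0, div_le_div_iff₀ hD hE, mul_comm 2 (m : ℝ), mul_assoc, mul_le_mul_iff_right₀ hm]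
  constructor <;> intro h <;> linarith

/-- `ηᴵ(m) = min(η₀(m), m/(β + (m−1)λ_k))` minimizes `gᴵ(m, ·) = g(λ_k; m, ·)` over
`(0, η₀(m)]`, with the indicated closed-form values in the two regimes. -/
theorem gI_minimizer
    (β lam1 lamk : ℝ) (hβ : lam1 < β) (h1k : lamk ≤ lam1) (hk : 0 < lamk)
    (m : ℕ) (hm : 1 ≤ m) :
    (∀ η : ℝ, 0 < η → η ≤ eta0 β lam1 lamk m →
        gq β m lamk (min (eta0 β lam1 lamk m) ((m : ℝ) / (β + ((m : ℝ) - 1) * lamk)))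
          ≤ gq β m lamk η)
    ∧ (((m : ℝ) ≤ β / (lam1 - lamk) + 1 ∨ lam1 = lamk) →
        gq β m lamk (min (eta0 β lam1 lamk m) ((m : ℝ) / (β + ((m : ℝ) - 1) * lamk)))
          = 1 - (m : ℝ) * lamk / (β + ((m : ℝ) - 1) * lamk))
    ∧ ((lamk < lam1 ∧ β / (lam1 - lamk) + 1 < (m : ℝ)) →
        gq β m lamk (min (eta0 β lam1 lamk m) ((m : ℝ) / (β + ((m : ℝ) - 1) * lamk)))
          = 1 - 4 * (m : ℝ) * ((m : ℝ) - 1) * lam1 * lamk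
              / (β + ((m : ℝ) - 1) * (lam1 + lamk)) ^ 2) := by
  have hm1 : (1 : ℝ) ≤ m := by exact_mod_cast hm
  have hm0 : (0 : ℝ) < m := by linarith
  have hβ0 : 0 < β := by linarith
  have hD : 0 < β + ((m : ℝ) - 1) * lamk :=
    add_pos_of_pos_of_nonneg hβ0 (mul_nonneg (by linarith) hk.le)
  have hE : 0 < β + ((m : ℝ) - 1) * (lam1 + lamk) :=
    add_pos_of_pos_of_nonneg hβ0 (mul_nonneg (by linarith) (by linarith))
  have hiff := div_le_eta0_iff hm0 hD hE
  refine ⟨fun η _ hη => ?_, fun h => ?_, fun ⟨hlt, h⟩ => ?_⟩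
  · rw [gq_eq_add_sq hm0.ne' hD.ne', gq_eq_add_sq hm0.ne' hD.ne' η]
    gcongr 1 - _ + _ * ?_
    rcases le_total ((m : ℝ) / (β + ((m : ℝ) - 1) * lamk)) (eta0 β lam1 lamk m) with hle | hle
    · rw [min_eq_right hle, sub_self, zero_pow two_ne_zero]
      positivity
    · rw [min_eq_left hle]
      exact sq_le_sq.2 (by
        rw [abs_of_nonpos (by linarith), abs_of_nonpos (by linarith)]
        linarith)
  · have hle : ((m : ℝ) - 1) * (lam1 - lamk) ≤ β := by
      rcases h1k.eq_or_lt with heq | hlt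
      · simpa [heq] using hβ0.le
      · rcases h with h | h
        · exact (le_div_iff₀ (sub_pos.2 hlt)).1 (by linarith)
        · exact absurd h hlt.ne'
    rw [min_eq_right (hiff.2 hle), gq_eq_add_sq hm0.ne' hD.ne']
    simp
  · have hgt : β < ((m : ℝ) - 1) * (lam1 - lamk) :=
      (div_lt_iff₀ (sub_pos.2 hlt)).1 (by linarith)
    rw [min_eq_left (not_le.1 (mt hiff.1 hgt.not_ge)).le, gq_eta0 hE.ne']
end

section
/- In the rate-function setting, for every η with η₀(m) ≤ η ≤ η₁(m): gᴵᴵ(m, η₀(m)) ≤ gᴵᴵ(m, η), and gᴵᴵ(m, η₀(m)) = 1 − 4m(m−1)λ₁λ_k/(β + (m−1)(λ₁ + λ_k))². -/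
/-- `η₁(m) = 2m/(β + (m−1)λ₁)`. -/
noncomputable def eta1 (β lam1 : ℝ) (m : ℕ) : ℝ :=
  2 * (m : ℝ) / (β + ((m : ℝ) - 1) * lam1)

/-- `gq` as a quadratic polynomial in `η`. -/
theorem gq_eq_quadratic (β : ℝ) {m : ℕ} (hm : m ≠ 0) (l η : ℝ) :
    gq β m l η = 1 - 2 * l * η + l * ((β + ((m : ℝ) - 1) * l) / m) * η ^ 2 := by
  have : (m : ℝ) ≠ 0 := by exact_mod_cast hm
  unfold gq
  field_simp
  ring

/-- To the right of its vertex `m / (β + (m - 1) l)`, `gq` is nondecreasing in `η`. -/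
theorem gq_le_gq {β l x y : ℝ} {m : ℕ} (hm : m ≠ 0) (hl : 0 ≤ l)
    (hA : 0 ≤ (β + ((m : ℝ) - 1) * l) / m) (hx : 1 ≤ (β + ((m : ℝ) - 1) * l) / m * x)
    (hxy : x ≤ y) : gq β m l x ≤ gq β m l y := by
  rw [gq_eq_quadratic β hm, gq_eq_quadratic β hm]
  set A := (β + ((m : ℝ) - 1) * l) / m
  have hy : A * x ≤ A * y := by gcongr
  have := mul_nonneg (mul_nonneg hl (sub_nonneg.2 hxy)) (by linarith : 0 ≤ A * x + A * y - 2)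
  linear_combination this

/-- On `[η₀(m), η₁(m)]`, `gᴵᴵ(m, ·) = g(λ₁; m, ·)` is minimized at the boundary
`η = η₀(m)`, with value `1 − 4m(m−1)λ₁λ_k/(β + (m−1)(λ₁ + λ_k))²`. -/
theorem gII_minimizer
    (β lam1 lamk : ℝ) (hβ : lam1 < β) (h1k : lamk ≤ lam1) (hk : 0 < lamk)
    (m : ℕ) (hm : 1 ≤ m) :
    (∀ η : ℝ, eta0 β lam1 lamk m ≤ η → η ≤ eta1 β lam1 m →
        gq β m lam1 (eta0 β lam1 lamk m) ≤ gq β m lam1 η)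
    ∧ gq β m lam1 (eta0 β lam1 lamk m)
        = 1 - 4 * (m : ℝ) * ((m : ℝ) - 1) * lam1 * lamk
            / (β + ((m : ℝ) - 1) * (lam1 + lamk)) ^ 2 := by
  have hm0 : m ≠ 0 := by lia
  have hm1 : (0 : ℝ) ≤ (m : ℝ) - 1 := by
    have : (1 : ℝ) ≤ m := by exact_mod_cast hm
    linarith
  have hmpos : (0 : ℝ) < m := by linarith
  have hl : 0 < lam1 := by linarith
  have hβ0 : 0 < β := by linarith
  have hD : 0 < β + ((m : ℝ) - 1) * (lam1 + lamk) := by positivity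
  refine ⟨fun η h0 _ => gq_le_gq hm0 hl.le (by positivity) ?_ h0, ?_⟩
  · unfold eta0
    rw [div_mul_div_comm, one_le_div (by positivity)]
    have h : β + ((m : ℝ) - 1) * (lam1 + lamk) ≤ 2 * (β + ((m : ℝ) - 1) * lam1) := by
      have := mul_le_mul_of_nonneg_left h1k hm1
      linarith
    linarith [mul_le_mul_of_nonneg_left h hmpos.le]
  · rw [gq_eq_quadratic β hm0, eta0]
    field_simp
    ring
end

section
/- In the rate-function setting, assume additionally that λ_k ≤ β/n and λ₁ > β/n for an integer n ≥ 1. Then for every batch size m ≥ 1, the step size η̂(m) satisfies max_{λ ∈ [λ_k, λ₁]} g(λ; m, η̂(m)) ≤ ĝ(m). -/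
/-- The rate at a step size of the form `s * m / D`. -/
lemma gq_mul_div (β l s D : ℝ) (m : ℕ) (hD : D ≠ 0) :
    gq β m l (s * m / D) =
      1 - s * m * l * (2 * D - s * (β + ((m : ℝ) - 1) * l)) / D ^ 2 := by
  unfold gq
  field_simp
  ring

/-- A concave quadratic bound on `[k, L]` obtained from its values at the two endpoints. -/
lemma mul_le_mul_add_of_mem_Icc {β k L c t l : ℝ} (hk : 0 < k) (hkc : k ≤ c) (hcL : c < L)
    (ht : 0 ≤ t) (htβ : t * (L - c) ≤ β) (hl : l ∈ Set.Icc k L) :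
    k * (β + t * c) ≤ l * (β + t * c + t * (c - l)) := by
  obtain ⟨hkl, hlL⟩ := hl
  have hL : 0 < L := hk.trans_le (hkl.trans hlL)
  have hright : 0 ≤ (L - k) * (β - t * (L - c)) + t * L * (c - k) :=
    add_nonneg (mul_nonneg (by linarith) (by linarith))
      (mul_nonneg (mul_nonneg ht hL.le) (by linarith))
  have hleft : 0 ≤ k * t * (c - k) := mul_nonneg (by positivity) (by linarith)
  have hconc : 0 ≤ t * ((l - k) * (L - l)) :=
    mul_nonneg ht (mul_nonneg (by linarith) (by linarith))
  have hlr := mul_nonneg (sub_nonneg.2 hkl) hright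
  have hll := mul_nonneg (sub_nonneg.2 hlL) hleft
  have hLk : 0 < L - k := by linarith
  have hcc := mul_nonneg hLk.le hconc
  rw [← sub_nonneg]
  refine nonneg_of_mul_nonneg_right ?_ hLk
  linear_combination hlr + hll + hcc

/-- The quadratic `l ↦ l * (L + c - l)` is at least `L * k` on `[k, L]` when `k ≤ c`. -/
lemma mul_le_mul_add_sub_of_mem_Icc {k L c l : ℝ} (hk : 0 < k) (hkc : k ≤ c)
    (hl : l ∈ Set.Icc k L) : L * k ≤ l * (L + c - l) := by
  obtain ⟨hkl, hlL⟩ := hl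
  have hconc : 0 ≤ (l - k) * (L - l) := mul_nonneg (by linarith) (by linarith)
  have hlin : 0 ≤ l * (c - k) := mul_nonneg (by linarith) (by linarith)
  linear_combination hconc + hlin

/-- Near-optimal step size with no dependence on `λ_k`: assuming `λ_k ≤ β/n < λ₁`,
the step size `η̂(m)` guarantees `max_{λ ∈ [λ_k, λ₁]} g(λ; m, η̂(m)) ≤ ĝ(m)` in each
of the two regimes. -/
theorem near_optimal_step_size
    (β lam1 lamk : ℝ) (hβ : lam1 < β) (h1k : lamk ≤ lam1) (hk : 0 < lamk)
    (n : ℕ) (hn : 1 ≤ n)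
    (hkn : lamk ≤ β / (n : ℝ)) (h1n : β / (n : ℝ) < lam1)
    (m : ℕ) (hm : 1 ≤ m) :
    ((m : ℝ) ≤ β / (lam1 - β / (n : ℝ)) + 1 →
      sSup ((fun l => gq β m l
            ((m : ℝ) / (β * (1 + ((m : ℝ) - 1) / (n : ℝ))))) '' Set.Icc lamk lam1)
        ≤ 1 - (m : ℝ) * lamk / (β * (1 + ((m : ℝ) - 1) / (n : ℝ))))
    ∧ (β / (lam1 - β / (n : ℝ)) + 1 < (m : ℝ) →
      sSup ((fun l => gq β m l
            (2 * (m : ℝ) / (β + ((m : ℝ) - 1) * (lam1 + β / (n : ℝ))))) ''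
          Set.Icc lamk lam1)
        ≤ 1 - 4 * (m : ℝ) * ((m : ℝ) - 1) * lam1 * lamk
            / (β + ((m : ℝ) - 1) * (lam1 + β / (n : ℝ))) ^ 2) := by
  have hm1 : (1 : ℝ) ≤ m := by exact_mod_cast hm
  have hm0 : (0 : ℝ) < m := by linarith
  have hn0 : (0 : ℝ) < n := by exact_mod_cast hn
  have hβ0 : 0 < β := by linarith
  have hne : (Set.Icc lamk lam1).Nonempty := Set.nonempty_Icc.2 h1k
  have ht : 0 ≤ (m : ℝ) - 1 := by linarith
  have hden : β * (1 + ((m : ℝ) - 1) / n) = β + ((m : ℝ) - 1) * (β / n) := by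
    field_simp
  have hc0 : 0 < β / (n : ℝ) := by positivity
  rw [hden]
  generalize β / (n : ℝ) = c at *
  have hLc : 0 < lam1 - c := by linarith
  constructor
  · intro hle
    have htβ : ((m : ℝ) - 1) * (lam1 - c) ≤ β := by
      rw [← le_div_iff₀ hLc]
      linarith
    refine csSup_le (hne.image _) ?_
    rintro _ ⟨l, hl, rfl⟩
    have hD : 0 < β + ((m : ℝ) - 1) * c := by positivity
    have key := mul_le_mul_add_of_mem_Icc hk hkn h1n ht htβ hl
    have hg := gq_mul_div β l 1 _ m hD.ne'
    rw [one_mul] at hg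
    dsimp only
    rw [hg]
    refine sub_le_sub_left ?_ 1
    rw [div_le_div_iff₀ hD (by positivity)]
    have := mul_le_mul_of_nonneg_left key (mul_pos hm0 hD).le
    linear_combination this
  · intro _
    refine csSup_le (hne.image _) ?_
    rintro _ ⟨l, hl, rfl⟩
    have hL : 0 < lam1 := by linarith
    have hE : 0 < β + ((m : ℝ) - 1) * (lam1 + c) := by positivity
    have key := mul_le_mul_add_sub_of_mem_Icc hk hkn hl
    dsimp only
    rw [gq_mul_div β l 2 _ m hE.ne']
    refine sub_le_sub_left (div_le_div_of_nonneg_right ?_ (by positivity)) 1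
    have := mul_le_mul_of_nonneg_left key (by positivity : 0 ≤ 4 * (m : ℝ) * ((m : ℝ) - 1))
    linear_combination this
end

section
/- In the rate-function setting, for every integer m ≥ 1: g*(1)^m ≤ g*(m), equivalently g*(1) ≤ g*(m)^{1/m}; that is, batch size m = 1 minimizes g*(m)^{1/m} over the positive integers (maximizing computational efficiency per gradient computation). -/
open scoped Classical

/-- The optimal convergence rate `g*(m)`: equal to `1 − mλ_k/(β + (m−1)λ_k)` when
`m ≤ β/(λ₁ − λ_k) + 1` (this branch for all `m` when `λ₁ = λ_k`), and to
`1 − 4m(m−1)λ₁λ_k/(β + (m−1)(λ₁ + λ_k))²` otherwise. -/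
noncomputable def gstar (β lam1 lamk : ℝ) (m : ℕ) : ℝ :=
  if (m : ℝ) ≤ β / (lam1 - lamk) + 1 ∨ lam1 = lamk then
    1 - (m : ℝ) * lamk / (β + ((m : ℝ) - 1) * lamk)
  else
    1 - 4 * (m : ℝ) * ((m : ℝ) - 1) * lam1 * lamk
        / (β + ((m : ℝ) - 1) * (lam1 + lamk)) ^ 2

theorem gstar_one (β lam1 lamk : ℝ) (hβ : 0 ≤ β) (h1k : lamk ≤ lam1) :
    gstar β lam1 lamk 1 = 1 - lamk / β := by
  have h : 0 ≤ β / (lam1 - lamk) := div_nonneg hβ (sub_nonneg.mpr h1k)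
  simp [gstar, h]

/-- By AM-GM, the first branch of `gstar` bounds the second one from below. -/
theorem one_sub_div_le_gstar (β lam1 lamk : ℝ) (hβ : 0 < β) (h1 : 0 ≤ lam1) (hk : 0 ≤ lamk)
    (n : ℕ) :
    1 - ((n : ℝ) + 1) * lamk / (β + n * lamk) ≤ gstar β lam1 lamk (n + 1) := by
  unfold gstar
  push_cast
  rw [add_sub_cancel_right]
  split_ifs
  · exact le_rfl
  · have hn : (0 : ℝ) ≤ n := n.cast_nonneg
    have hA : 0 < β + n * lamk := by positivity
    have hB : 0 < β + n * (lam1 + lamk) := by positivity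
    refine sub_le_sub_left ?_ 1
    rw [div_le_div_iff₀ (by positivity) hA]
    have hsq : 4 * (n * lam1) * (β + n * lamk) ≤ (β + n * (lam1 + lamk)) ^ 2 := by
      linarith [sq_nonneg (β + n * lamk - n * lam1)]
    have hc : 0 ≤ ((n : ℝ) + 1) * lamk := by positivity
    linarith [mul_le_mul_of_nonneg_left hsq hc]

theorem one_sub_pow_mul_one_add_mul_le_one {x : ℝ} (h0 : 0 ≤ x) (h1 : x ≤ 1) (n : ℕ) :
    (1 - x) ^ n * (1 + n * x) ≤ 1 := by
  have hx : 0 ≤ 1 - x := sub_nonneg.mpr h1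
  calc (1 - x) ^ n * (1 + n * x) ≤ (1 - x) ^ n * (1 + x) ^ n := by
        gcongr
        exact one_add_mul_le_pow (by linarith) n
    _ = (1 - x ^ 2) ^ n := by rw [← mul_pow]; ring
    _ ≤ 1 := pow_le_one₀ (by nlinarith) (by nlinarith)

/-- Batch size `m = 1` maximizes computational efficiency:
`g*(1)^m ≤ g*(m)` for every `m ≥ 1`, i.e. `g*(1) ≤ g*(m)^(1/m)`. -/
theorem batch_size_one_optimal
    (β lam1 lamk : ℝ) (hβ : lam1 < β) (h1k : lamk ≤ lam1) (hk : 0 < lamk)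
    (m : ℕ) (hm : 1 ≤ m) :
    gstar β lam1 lamk 1 ^ m ≤ gstar β lam1 lamk m := by
  obtain ⟨n, rfl⟩ := Nat.exists_eq_add_of_le' hm
  have hβ0 : 0 < β := by linarith
  refine le_trans ?_ (one_sub_div_le_gstar β lam1 lamk hβ0 (by linarith) hk.le n)
  rw [gstar_one β lam1 lamk hβ0.le h1k]
  have hx0 : 0 ≤ lamk / β := by positivity
  have hx1 : lamk / β ≤ 1 := (div_le_one hβ0).mpr (by linarith)
  have hA : 0 < β + n * lamk := by positivity
  have hrhs : 1 - ((n : ℝ) + 1) * lamk / (β + n * lamk)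
      = (1 - lamk / β) / (1 + n * (lamk / β)) := by
    have : 0 < 1 + n * (lamk / β) := by positivity
    field_simp
    ring
  rw [hrhs, le_div_iff₀ (by positivity), pow_succ, mul_right_comm]
  exact mul_le_of_le_one_left (sub_nonneg.mpr hx1)
    (one_sub_pow_mul_one_add_mul_le_one hx0 hx1 n)
end

section
/- In the rate-function setting, assume additionally that λ_k ≤ β/n and λ₁ > β/n for an integer n ≥ 1. Then for every integer m ≥ 1: ĝ(1)^m ≤ ĝ(m), equivalently ĝ(1) ≤ ĝ(m)^{1/m}; that is, when the near-optimal step size η̂(m) is used, batch size m = 1 minimizes ĝ(m)^{1/m} over the positive integers. -/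
open scoped Classical

/-- The near-optimal convergence rate `ĝ(m)` obtained with the step size `η̂(m)` that
does not depend on `λ_k`: equal to `1 − mλ_k/(β(1 + (m−1)/n))` when
`m ≤ β/(λ₁ − β/n) + 1`, and to `1 − 4m(m−1)λ₁λ_k/(β + (m−1)(λ₁ + β/n))²` otherwise. -/
noncomputable def ghat (β lam1 lamk : ℝ) (n m : ℕ) : ℝ :=
  if (m : ℝ) ≤ β / (lam1 - β / (n : ℝ)) + 1 then
    1 - (m : ℝ) * lamk / (β * (1 + ((m : ℝ) - 1) / (n : ℝ)))
  else
    1 - 4 * (m : ℝ) * ((m : ℝ) - 1) * lam1 * lamk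
        / (β + ((m : ℝ) - 1) * (lam1 + β / (n : ℝ))) ^ 2

/-- The first branch of `ghat` bounds it from below on both branches. -/
theorem one_sub_div_le_ghat {β lam1 lamk : ℝ} (hβ : 0 < β) (h1 : 0 ≤ lam1) (hk : 0 ≤ lamk)
    (n : ℕ) {m : ℕ} (hm : 1 ≤ m) :
    1 - (m : ℝ) * lamk / (β * (1 + ((m : ℝ) - 1) / (n : ℝ))) ≤ ghat β lam1 lamk n m := by
  unfold ghat
  split_ifs
  · exact le_rfl
  · have hs : (0 : ℝ) ≤ (m : ℝ) - 1 := sub_nonneg.2 (mod_cast hm)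
    have hD : 0 < β * (1 + ((m : ℝ) - 1) / (n : ℝ)) := by positivity
    have hp : 0 ≤ ((m : ℝ) - 1) * lam1 := by positivity
    have hsplit : β + ((m : ℝ) - 1) * (lam1 + β / (n : ℝ))
        = β * (1 + ((m : ℝ) - 1) / (n : ℝ)) + ((m : ℝ) - 1) * lam1 := by ring
    rw [hsplit]
    generalize β * (1 + ((m : ℝ) - 1) / (n : ℝ)) = D at hD
    have hmk : 0 ≤ (m : ℝ) * lamk := by positivity
    apply sub_le_sub_left
    rw [div_le_div_iff₀ (by positivity) hD]
    nlinarith [mul_nonneg hmk (sq_nonneg (D - ((m : ℝ) - 1) * lam1))]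

/-- A reverse Bernoulli inequality. -/
theorem one_sub_pow_succ_le {y q : ℝ} (hy : 0 ≤ y) (hy1 : y ≤ 1) (hyq : y ≤ q) (s : ℕ) :
    (1 - y) ^ (s + 1) ≤ 1 - ((s : ℝ) + 1) * y / (1 + s * q) := by
  have hpos : 0 < 1 + (s : ℝ) * y := by positivity
  have hbern : 1 + (s : ℝ) * y ≤ (1 + y) ^ s :=
    one_add_mul_le_pow (by linarith) s
  have hprod : (1 - y) ^ s * (1 + s * y) ≤ 1 := by
    calc (1 - y) ^ s * (1 + s * y) ≤ (1 - y) ^ s * (1 + y) ^ s :=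
          mul_le_mul_of_nonneg_left hbern (pow_nonneg (by linarith) s)
      _ = (1 - y ^ 2) ^ s := by rw [← mul_pow]; ring
      _ ≤ 1 := pow_le_one₀ (by nlinarith) (by nlinarith)
  calc (1 - y) ^ (s + 1) ≤ (1 - y) / (1 + s * y) := by
        rw [le_div_iff₀ hpos, pow_succ]
        nlinarith
    _ = 1 - ((s : ℝ) + 1) * y / (1 + s * y) := by
        field_simp
        ring
    _ ≤ 1 - ((s : ℝ) + 1) * y / (1 + s * q) := by gcongr

/-- When the near-optimal step size `η̂(m)` is used, batch size `m = 1` still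
maximizes computational efficiency: `ĝ(1)^m ≤ ĝ(m)` for every `m ≥ 1`,
i.e. `ĝ(1) ≤ ĝ(m)^(1/m)`. -/
theorem batch_size_one_optimal_near_optimal_step
    (β lam1 lamk : ℝ) (hβ : lam1 < β) (h1k : lamk ≤ lam1) (hk : 0 < lamk)
    (n : ℕ) (hn : 1 ≤ n)
    (hkn : lamk ≤ β / (n : ℝ)) (h1n : β / (n : ℝ) < lam1)
    (m : ℕ) (hm : 1 ≤ m) :
    ghat β lam1 lamk n 1 ^ m ≤ ghat β lam1 lamk n m := by
  have h1 : 0 < lam1 := hk.trans_le h1k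
  have hβ0 : 0 < β := h1.trans hβ
  have hn0 : (0 : ℝ) < n := by exact_mod_cast hn
  have hone : ghat β lam1 lamk n 1 = 1 - lamk / β := by
    have hle : ((1 : ℕ) : ℝ) ≤ β / (lam1 - β / (n : ℝ)) + 1 := by
      have := div_nonneg hβ0.le (sub_nonneg.2 h1n.le)
      push_cast
      linarith
    rw [ghat, if_pos hle]
    simp
  refine le_trans ?_ (one_sub_div_le_ghat hβ0 h1.le hk.le n hm)
  obtain ⟨s, rfl⟩ := Nat.exists_eq_add_of_le' hm
  have hyq : lamk / β ≤ 1 / (n : ℝ) := by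
    rw [div_le_iff₀ hβ0]
    calc lamk ≤ β / (n : ℝ) := hkn
      _ = 1 / (n : ℝ) * β := by ring
  have hy1 : lamk / β ≤ 1 := (div_le_one hβ0).2 (h1k.trans hβ.le)
  rw [hone]
  refine (one_sub_pow_succ_le (by positivity) hy1 hyq s).trans_eq ?_
  push_cast
  rw [add_sub_cancel_right, mul_one_div, mul_div_assoc', div_div]
end

section
/- Let β, λ_k be reals with 0 < λ_k < β, and define g₁(x) = 1 − xλ_k/(β + (x−1)λ_k) for real x ≥ 1 (so g₁(x) = (β − λ_k)/(β + (x−1)λ_k) ∈ (0,1)). Then the function x ↦ g₁(x)^{1/x} is strictly increasing on [1, ∞); equivalently, T(x) = (1/x)·log(1/g₁(x)) is strictly decreasing on [1, ∞). -/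
theorem strictAntiOn_log_one_add_mul_div {c : ℝ} (hc : 0 < c) :
    StrictAntiOn (fun x : ℝ => Real.log (1 + c * x) / x) (Set.Ioi 0) := by
  intro x hx y hy hxy
  have hx : 0 < x := hx
  have hy : 0 < y := hy
  have hcx : 0 < c * x := mul_pos hc hx
  have hcxy : c * x < c * y := mul_lt_mul_of_pos_left hxy hc
  have h := strictConcaveOn_log_Ioi.slope_anti_adjacent (x := 1) (y := 1 + c * x)
    (z := 1 + c * y) (Set.mem_Ioi.2 one_pos) (Set.mem_Ioi.2 (by linarith))
    (by linarith) (by linarith)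
  rw [div_lt_div_iff₀ (by linarith) (by linarith), Real.log_one] at h
  change Real.log (1 + c * y) / y < Real.log (1 + c * x) / x
  rw [div_lt_div_iff₀ hy hx]
  refine lt_of_mul_lt_mul_left ?_ hc.le
  linarith

theorem one_sub_mul_div_eq_inv {b l x : ℝ} (hl : 0 < l) (hb : l < b) (hx : 0 < x) :
    1 - x * l / (b + (x - 1) * l) = (1 + l / (b - l) * x)⁻¹ := by
  have hbl : 0 < b - l := sub_pos.2 hb
  have hden : 0 < b + (x - 1) * l := by nlinarith [mul_pos hx hl]
  have hsum : 1 + l / (b - l) * x = (b + (x - 1) * l) / (b - l) := by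
    field_simp
    ring
  rw [hsum, inv_div, eq_div_iff hden.ne', sub_mul, div_mul_cancel₀ _ hden.ne']
  ring

/-- For `0 < λ_k < β` and `g₁(x) = 1 − xλ_k/(β + (x−1)λ_k)`, the function
`x ↦ g₁(x)^(1/x)` is strictly increasing on `[1, ∞)`; equivalently,
`T(x) = (1/x)·log(1/g₁(x))` is strictly decreasing on `[1, ∞)`. -/
theorem g1_root_strictly_increasing
    (β lamk : ℝ) (h0 : 0 < lamk) (h1 : lamk < β) :
    StrictMonoOn
        (fun x : ℝ => (1 - x * lamk / (β + (x - 1) * lamk)) ^ (1 / x)) (Set.Ici 1)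
    ∧ StrictAntiOn
        (fun x : ℝ => (1 / x) * Real.log (1 / (1 - x * lamk / (β + (x - 1) * lamk))))
        (Set.Ici 1) := by
  have hc : 0 < lamk / (β - lamk) := div_pos h0 (sub_pos.2 h1)
  have hpos : ∀ x ∈ Set.Ici (1 : ℝ), 0 < x := fun x hx => one_pos.trans_le hx
  have hanti : StrictAntiOn
      (fun x : ℝ => (1 / x) * Real.log (1 / (1 - x * lamk / (β + (x - 1) * lamk))))
      (Set.Ici 1) := by
    refine ((strictAntiOn_log_one_add_mul_div hc).mono hpos).congr fun x hx => ?_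
    simp only [one_sub_mul_div_eq_inv h0 h1 (hpos x hx), one_div, inv_inv]
    exact div_eq_inv_mul _ _
  refine ⟨(Real.exp_strictMono.comp_strictMonoOn hanti.neg).congr fun x hx => ?_, hanti⟩
  have hg : 0 < 1 - x * lamk / (β + (x - 1) * lamk) := by
    rw [one_sub_mul_div_eq_inv h0 h1 (hpos x hx)]
    have := mul_pos hc (hpos x hx)
    positivity
  simp only [Function.comp_apply]
  rw [Real.rpow_def_of_pos hg, one_div (1 - _), Real.log_inv]
  ring_nf
end

section
/- Let β > 0 and 0 < λ_k ≤ λ₁ be reals, and for real x ≥ 1 define g₁(x) = 1 − xλ_k/(β + (x−1)λ_k) and g₂(x) = 1 − 4x(x−1)λ₁λ_k/(β + (x−1)(λ₁ + λ_k))². Then g₁(x) ≤ g₂(x) for every x ≥ 1. -/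
/-- For `β > 0` and `0 < λ_k ≤ λ₁`, the first branch of the optimal rate is below the
second: `g₁(x) = 1 − xλ_k/(β + (x−1)λ_k) ≤ g₂(x) = 1 − 4x(x−1)λ₁λ_k/(β + (x−1)(λ₁ + λ_k))²`
for every real `x ≥ 1`. -/
theorem g1_le_g2
    (β lam1 lamk : ℝ) (hβ : 0 < β) (hk : 0 < lamk) (h1k : lamk ≤ lam1) :
    ∀ x : ℝ, 1 ≤ x →
      1 - x * lamk / (β + (x - 1) * lamk)
        ≤ 1 - 4 * x * (x - 1) * lam1 * lamk / (β + (x - 1) * (lam1 + lamk)) ^ 2 := by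
  intro x hx
  have hx0 : 0 < x := by linarith
  have ht : 0 ≤ x - 1 := by linarith
  have hlam1 : 0 < lam1 := hk.trans_le h1k
  have ha : 0 < β + (x - 1) * lamk := by positivity
  have hd : 0 < (β + (x - 1) * (lam1 + lamk)) ^ 2 := by positivity
  refine sub_le_sub_left ?_ 1
  rw [div_le_div_iff₀ hd ha]
  -- AM-GM for `β + (x - 1) * lamk` and `(x - 1) * lam1`, multiplied by `x * lamk`
  have amgm := mul_le_mul_of_nonneg_left
    (four_mul_le_sq_add (β + (x - 1) * lamk) ((x - 1) * lam1)) (mul_pos hx0 hk).le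
  linear_combination amgm
end
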